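/- For every integer n ≥ 1 and every real number d, the integral over ℝ^{n−1} (with respect to (n−1)-dimensional Lebesgue measure) of the function (s₁,…,s_{n−1}) ↦ (∏_{i=1}^{n−1} 1/(2·cosh(sᵢ/2))) · 1/(2·cosh((d − s₁ − ⋯ − s_{n−1})/2)) equals ((2π)^{n−2} / (n−1)!) · ‖Γ(n/2 + i·d/(2π))‖², where Γ is the complex Gamma function, i is the imaginary unit, and (2π)^{n−2} is understood as an integer power (so (2π)^{−1} = 1/(2π) when n = 1). -/

import Mathlib

open MeasureTheory Real

/-- The function `x ↦ 1 / (2 cosh (x / 2))`. -/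
noncomputable def halfSech (x : ℝ) : ℝ := 1 / (2 * Real.cosh (x / 2))

lemma halfSech_pos (x : ℝ) : 0 < halfSech x := by
  unfold halfSech
  have := Real.cosh_pos (x / 2)
  positivity

lemma halfSech_neg (x : ℝ) : halfSech (-x) = halfSech x := by
  simp [halfSech, neg_div]

lemma halfSech_le_one (x : ℝ) : halfSech x ≤ 1 := by
  unfold halfSech
  have := Real.one_le_cosh (x / 2)
  rw [div_le_one (by linarith)]
  linarith

@[fun_prop]
lemma continuous_halfSech : Continuous halfSech := by
  unfold halfSech
  refine continuous_const.div (by fun_prop) fun x => ?_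
  have := Real.cosh_pos (x / 2)
  positivity

lemma sigmoid_eq_exp_mul_halfSech (x : ℝ) :
    Real.sigmoid x = Real.exp (x / 2) * halfSech x := by
  have h : Real.exp (-x) = Real.exp (-(x / 2)) * Real.exp (-(x / 2)) := by
    rw [← Real.exp_add]; ring_nf
  have h' : Real.exp (x / 2) * Real.exp (-(x / 2)) = 1 := by
    rw [← Real.exp_add]; simp
  rw [Real.sigmoid_def, halfSech, Real.cosh_eq, h]
  have h1 := Real.exp_pos (x / 2)
  have h2 := Real.exp_pos (-(x / 2))
  field_simp
  linear_combination -Real.exp (-(x / 2)) * h'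

lemma one_sub_sigmoid_eq_exp_mul_halfSech (x : ℝ) :
    1 - Real.sigmoid x = Real.exp (-(x / 2)) * halfSech x := by
  rw [← Real.sigmoid_neg, sigmoid_eq_exp_mul_halfSech, halfSech_neg, neg_div]

lemma ofReal_exp_mul_cpow (a : ℝ) {b : ℝ} (hb : 0 < b) (w : ℂ) :
    ((Real.exp a * b : ℝ) : ℂ) ^ w = Complex.exp (a * w) * (b : ℂ) ^ w := by
  rw [Complex.ofReal_mul, Complex.mul_cpow_ofReal_nonneg (Real.exp_pos a).le hb.le,
    Complex.cpow_def_of_ne_zero (by exact_mod_cast (Real.exp_pos a).ne'),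
    ← Complex.ofReal_log (Real.exp_pos a).le, Real.log_exp]

/-- The integrand of the Beta integral after the substitution `t = sigmoid x`. -/
lemma abs_deriv_sigmoid_smul_beta_integrand (u v : ℂ) (x : ℝ) :
    |Real.sigmoid x * (1 - Real.sigmoid x)| •
        ((Real.sigmoid x : ℂ) ^ (u - 1) * (1 - (Real.sigmoid x : ℂ)) ^ (v - 1)) =
      Complex.exp ((u - v) * x / 2) * (halfSech x : ℂ) ^ (u + v) := by
  have h0 := Real.sigmoid_pos x
  have h1 : 0 < 1 - Real.sigmoid x := sub_pos.2 (Real.sigmoid_lt_one x)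
  have hg : (halfSech x : ℂ) ≠ 0 := by exact_mod_cast (halfSech_pos x).ne'
  have e0 : ((Real.sigmoid x : ℝ) : ℂ) ≠ 0 := by exact_mod_cast h0.ne'
  have e1 : ((1 - Real.sigmoid x : ℝ) : ℂ) ≠ 0 := by exact_mod_cast h1.ne'
  rw [abs_of_pos (mul_pos h0 h1), Complex.real_smul, ← Complex.ofReal_one, ← Complex.ofReal_sub,
    Complex.ofReal_one, Complex.cpow_sub _ _ e0, Complex.cpow_sub _ _ e1, Complex.cpow_one,
    Complex.cpow_one, Complex.ofReal_mul]
  have : ∀ a b p q : ℂ, a ≠ 0 → b ≠ 0 → a * b * (p / a * (q / b)) = p * q := by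
    intro a b p q ha hb
    field_simp
  rw [this _ _ _ _ e0 e1, one_sub_sigmoid_eq_exp_mul_halfSech, sigmoid_eq_exp_mul_halfSech,
    ofReal_exp_mul_cpow _ (halfSech_pos x), ofReal_exp_mul_cpow _ (halfSech_pos x),
    Complex.cpow_add _ _ hg]
  have : Complex.exp ((u - v) * x / 2) =
      Complex.exp ((x / 2 : ℝ) * u) * Complex.exp ((-(x / 2) : ℝ) * v) := by
    rw [← Complex.exp_add]
    congr 1
    push_cast
    ring
  rw [this]
  ring

lemma betaIntegral_eq_integral_exp_mul_halfSech (u v : ℂ) :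
    Complex.betaIntegral u v =
      ∫ x : ℝ, Complex.exp ((u - v) * x / 2) * (halfSech x : ℂ) ^ (u + v) := by
  have h := integral_image_eq_integral_abs_deriv_smul MeasurableSet.univ
    (fun x _ => (Real.hasDerivAt_sigmoid x).hasDerivWithinAt) Real.sigmoid_injective.injOn
    (fun t : ℝ => (t : ℂ) ^ (u - 1) * (1 - (t : ℂ)) ^ (v - 1))
  rw [Set.image_univ, Real.range_sigmoid, Measure.restrict_univ] at h
  rw [Complex.betaIntegral, intervalIntegral.integral_of_le zero_le_one,
    integral_Ioc_eq_integral_Ioo, h]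
  simp_rw [abs_deriv_sigmoid_smul_beta_integrand]

lemma integrable_halfSech : Integrable halfSech := by
  have h := integrableOn_image_iff_integrableOn_abs_deriv_smul MeasurableSet.univ
    (fun x _ => (Real.hasDerivAt_sigmoid x).hasDerivWithinAt) Real.sigmoid_injective.injOn
    (fun t : ℝ => (t : ℂ) ^ ((1 / 2 : ℂ) - 1) * (1 - (t : ℂ)) ^ ((1 / 2 : ℂ) - 1))
  rw [Set.image_univ, Real.range_sigmoid, integrableOn_univ] at h
  simp_rw [abs_deriv_sigmoid_smul_beta_integrand] at h
  have hb := Complex.betaIntegral_convergent (u := 1 / 2) (v := 1 / 2) (by norm_num) (by norm_num)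
  rw [intervalIntegrable_iff_integrableOn_Ioo_of_le zero_le_one] at hb
  convert! (h.1 hb).re using 2 with x
  norm_num

/-- The Fourier transform of `halfSech ^ n`. -/
lemma integral_exp_mul_halfSech_pow (n : ℕ) (hn : 1 ≤ n) (y : ℝ) :
    ∫ x : ℝ, Complex.exp (Complex.I * y * x) * (halfSech x : ℂ) ^ n =
      ((‖Complex.Gamma ((n : ℂ) / 2 + Complex.I * y)‖ ^ 2 / (n - 1).factorial : ℝ) : ℂ) := by
  have hn' : (0 : ℝ) < n := by exact_mod_cast hn
  set u : ℂ := (n : ℂ) / 2 + Complex.I * y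
  set v : ℂ := (n : ℂ) / 2 - Complex.I * y
  have huv : u + v = n := by simp only [u, v]; ring
  have hu : 0 < u.re := by simpa [u] using hn'
  have hv : 0 < v.re := by simpa [v] using hn'
  have hc : v = (starRingEnd ℂ) u := by
    simp [u, v, sub_eq_add_neg, Complex.conj_ofNat]
  have hG : Complex.Gamma n = ((n - 1).factorial : ℂ) := by
    obtain ⟨m, rfl⟩ := Nat.exists_eq_add_of_le' hn
    simpa using Complex.Gamma_nat_eq_factorial m
  have hf : ((n - 1).factorial : ℂ) ≠ 0 := by exact_mod_cast (n - 1).factorial_ne_zero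
  have h := Complex.Gamma_mul_Gamma_eq_betaIntegral hu hv
  rw [betaIntegral_eq_integral_exp_mul_halfSech, huv, hG, hc, Complex.Gamma_conj,
    Complex.mul_conj, Complex.normSq_eq_norm_sq, ← hc] at h
  have huv' : ∀ x : ℝ, (u - v) * x / 2 = Complex.I * y * x := by
    intro x; simp only [u, v]; ring
  simp_rw [huv', Complex.cpow_natCast] at h
  rw [Complex.ofReal_div, h, Complex.ofReal_natCast, mul_div_cancel_left₀ _ hf]

/-- `halfSech` is, up to scaling, its own Fourier transform. -/
lemma integral_exp_mul_halfSech (y : ℝ) :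
    ∫ x : ℝ, Complex.exp (Complex.I * y * x) * (halfSech x : ℂ) =
      2 * π * (halfSech (2 * π * y) : ℂ) := by
  have h := integral_exp_mul_halfSech_pow 1 le_rfl y
  simp only [pow_one] at h
  rw [h]
  have hc : Complex.Gamma (1 - (1 / 2 + Complex.I * y)) =
      (starRingEnd ℂ) (Complex.Gamma (1 / 2 + Complex.I * y)) := by
    rw [← Complex.Gamma_conj]
    congr 1
    simp [Complex.conj_ofNat]
    ring
  have h2 := Complex.Gamma_mul_Gamma_one_sub (1 / 2 + Complex.I * y)
  rw [hc, Complex.mul_conj, Complex.normSq_eq_norm_sq] at h2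
  have hs : Complex.sin (π * (1 / 2 + Complex.I * y)) = (Real.cosh (π * y) : ℂ) := by
    rw [show (π : ℂ) * (1 / 2 + Complex.I * y) = (π * y : ℂ) * Complex.I + π / 2 by ring,
      Complex.sin_add_pi_div_two, Complex.cos_mul_I]
    push_cast
    rfl
  rw [hs] at h2
  simp only [Nat.cast_one, Nat.sub_self, Nat.factorial_zero, div_one]
  rw [h2, halfSech, show 2 * π * y / 2 = π * y by ring]
  have : (Real.cosh (π * y) : ℂ) ≠ 0 := by exact_mod_cast (Real.cosh_pos _).ne'
  push_cast at this ⊢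
  field_simp

/-- The `(m + 1)`-fold convolution of `halfSech` with itself. -/
noncomputable def halfSechConv (m : ℕ) (d : ℝ) : ℝ :=
  ∫ s : Fin m → ℝ, (∏ i, halfSech (s i)) * halfSech (d - ∑ i, s i)

lemma integrable_prod_halfSech_mul (m : ℕ) (d : ℝ) :
    Integrable fun s : Fin m → ℝ => (∏ i, halfSech (s i)) * halfSech (d - ∑ i, s i) := by
  refine (Integrable.fintype_prod fun _ => integrable_halfSech).mul_bdd (c := 1) ?_ ?_
  · exact Continuous.aestronglyMeasurable (by fun_prop)
  · refine .of_forall fun s => ?_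
    rw [Real.norm_of_nonneg (halfSech_pos _).le]
    exact halfSech_le_one _

lemma halfSechConv_succ (m : ℕ) (d : ℝ) :
    halfSechConv (m + 1) d = ∫ x, halfSech x * halfSechConv m (d - x) := by
  have hem := (volume_preserving_piFinSuccAbove (fun _ : Fin (m + 1) => ℝ) 0).symm
  have hi := (hem.integrable_comp_emb (MeasurableEquiv.measurableEmbedding _)).2
    (integrable_prod_halfSech_mul (m + 1) d)
  rw [halfSechConv, ← hem.integral_comp']
  rw [Measure.volume_eq_prod] at hi ⊢
  refine (integral_prod _ hi).trans ?_
  refine integral_congr_ae (.of_forall fun x => ?_)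
  simp only [halfSechConv, Function.comp_apply, MeasurableEquiv.piFinSuccAbove_symm_apply, Fin.insertNthEquiv,
    Fin.prod_univ_succ, Fin.sum_univ_succ, Fin.insertNth_zero, Equiv.coe_fn_mk, Fin.cons_succ,
    Fin.zero_succAbove, cast_eq, Fin.cons_zero]
  rw [← integral_const_mul]
  simp only [mul_assoc, sub_sub]

lemma integral_halfSech_mul_integral_exp (n : ℕ) (hn : 1 ≤ n) (d : ℝ) :
    ∫ s : ℝ, (halfSech s : ℂ) *
        ∫ x : ℝ, Complex.exp (Complex.I * ((d - s) / (2 * π) : ℝ) * x) * (halfSech x : ℂ) ^ n =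
      2 * π * ∫ x : ℝ, Complex.exp (Complex.I * (d / (2 * π) : ℝ) * x) *
        (halfSech x : ℂ) ^ (n + 1) := by
  simp_rw [← integral_const_mul]
  rw [integral_integral_swap]
  · refine integral_congr_ae (.of_forall fun x => ?_)
    have h := integral_exp_mul_halfSech (-(x / (2 * π)))
    rw [show 2 * π * -(x / (2 * π)) = -x by field_simp, halfSech_neg] at h
    calc _ = ∫ s : ℝ, (Complex.exp (Complex.I * (d / (2 * π) : ℝ) * x) * (halfSech x : ℂ) ^ n) *
          (Complex.exp (Complex.I * (-(x / (2 * π)) : ℝ) * s) * (halfSech s : ℂ)) := by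
            refine integral_congr_ae (.of_forall fun s => ?_)
            have : Complex.exp (Complex.I * ((d - s) / (2 * π) : ℝ) * x) =
                Complex.exp (Complex.I * (d / (2 * π) : ℝ) * x) *
                  Complex.exp (Complex.I * (-(x / (2 * π)) : ℝ) * s) := by
              rw [← Complex.exp_add]
              congr 1
              push_cast
              ring
            simp only [this]
            ring
      _ = _ := by
            rw [integral_const_mul, h]
            ring
  · have hp : Integrable (fun p : ℝ × ℝ => halfSech p.1 * halfSech p.2) (volume.prod volume) :=
      integrable_halfSech.mul_prod integrable_halfSech
    refine hp.mono' (Continuous.aestronglyMeasurable ?_) (.of_forall fun p => ?_)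
    · unfold Function.uncurry
      fun_prop
    · have he : ‖Complex.exp (Complex.I * ((d - p.1) / (2 * π) : ℝ) * p.2)‖ = 1 := by
        rw [mul_assoc, ← Complex.ofReal_mul, Complex.norm_exp_I_mul_ofReal]
      simp only [Function.uncurry, norm_mul, norm_pow, he, one_mul, Complex.norm_real,
        Real.norm_of_nonneg (halfSech_pos _).le]
      refine mul_le_mul_of_nonneg_left ?_ (halfSech_pos _).le
      exact pow_le_of_le_one (halfSech_pos _).le (halfSech_le_one _) (by omega)

lemma halfSechConv_eq_integral_exp (m : ℕ) (d : ℝ) :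
    2 * π * (halfSechConv m d : ℂ) = (2 * π) ^ m *
      ∫ x : ℝ, Complex.exp (Complex.I * (d / (2 * π) : ℝ) * x) * (halfSech x : ℂ) ^ (m + 1) := by
  induction m generalizing d with
  | zero =>
    simp only [zero_add, pow_one, pow_zero, one_mul]
    rw [integral_exp_mul_halfSech, show 2 * π * (d / (2 * π)) = d by field_simp]
    simp [halfSechConv, volume_pi, measureReal_def]
  | succ m ih =>
    rw [halfSechConv_succ, ← integral_complex_ofReal, pow_succ, mul_assoc (_ ^ m),
      ← integral_halfSech_mul_integral_exp (m + 1) (by omega), ← integral_const_mul,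
      ← integral_const_mul]
    refine integral_congr_ae (.of_forall fun s => ?_)
    simp only [Complex.ofReal_mul]
    linear_combination (halfSech s : ℂ) * ih (d - s)

/-- The `n`-fold convolution of `x ↦ 1/(2 cosh(x/2))` with itself, evaluated at `d`,
equals `(2π)^{n-2}/(n-1)! · ‖Γ(n/2 + i d/(2π))‖²`. -/
theorem crown_volume_gamma (n : ℕ) (hn : 1 ≤ n) (d : ℝ) :
    (∫ s : Fin (n - 1) → ℝ,
        (∏ i, 1 / (2 * Real.cosh (s i / 2))) *
          (1 / (2 * Real.cosh ((d - ∑ i, s i) / 2))))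
      = (2 * Real.pi) ^ ((n : ℤ) - 2) / (Nat.factorial (n - 1) : ℝ) *
          ‖Complex.Gamma ((n : ℂ) / 2 + Complex.I * (d : ℂ) / (2 * (Real.pi : ℂ)))‖ ^ 2 := by
  obtain ⟨m, rfl⟩ := Nat.exists_eq_add_of_le' hn
  change halfSechConv m d = _
  have h := halfSechConv_eq_integral_exp m d
  rw [integral_exp_mul_halfSech_pow (m + 1) hn] at h
  have hpi : (2 * π) ≠ 0 := by positivity
  rw [show Complex.I * (d : ℂ) / (2 * (π : ℂ)) = Complex.I * (d / (2 * π) : ℝ) by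
      push_cast; ring,
    show ((m + 1 : ℕ) : ℤ) - 2 = (m : ℤ) - 1 by push_cast; ring, zpow_sub_one₀ hpi, zpow_natCast]
  have h' : 2 * π * halfSechConv m d = (2 * π) ^ m *
      (‖Complex.Gamma (((m + 1 : ℕ) : ℂ) / 2 + Complex.I * (d / (2 * π) : ℝ))‖ ^ 2 /
        (m + 1 - 1).factorial) := by
    exact_mod_cast h
  rw [eq_comm, ← mul_right_inj' hpi, h']
  push_cast
  field_simp
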